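/- Uniqueness of normal form: every φ-term has at most one normal form; that is, if t ⇝* u and t ⇝* v with u and v both in normal form, then u = v. -/

import Mathlib

namespace PhiCalc

/-- φ-terms over a set of attribute labels `L`. An object term carries a finite
list of attributes: `(a, none)` is a void attribute, `(b, some t)` is an
attached attribute. -/
inductive Tm (L : Type) : Type where
  | loc : Nat → Tm L
  | dot : Tm L → L → Tm L
  | app : Tm L → L → Tm L → Tm L
  | obj : List (L × Option (Tm L)) → Tm L

namespace Tm

variable {L : Type}

/-- Look up a label among the attributes of an object:
`none` = the label is missing, `some none` = void attribute,
`some (some t)` = attribute attached to `t`. -/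
def lookupAttr [DecidableEq L] (a : L) : List (L × Option (Tm L)) → Option (Option (Tm L))
  | [] => none
  | (b, o) :: rest => if a = b then some o else lookupAttr a rest

/-- Attach term `u` to the (first occurrence of) label `a`. -/
def attachAttr [DecidableEq L] (a : L) (u : Tm L) :
    List (L × Option (Tm L)) → List (L × Option (Tm L))
  | [] => []
  | (b, o) :: rest => if a = b then (b, some u) :: rest else (b, o) :: attachAttr a u rest

mutual
/-- Locator increment `↑ₙ t`. -/
def incAt : Nat → Tm L → Tm L
  | n, loc m => if m < n then loc m else loc (m + 1)
  | n, dot t a => dot (incAt n t) a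
  | n, app t a u => app (incAt n t) a (incAt n u)
  | n, obj attrs => obj (incAtList (n + 1) attrs)

def incAtList : Nat → List (L × Option (Tm L)) → List (L × Option (Tm L))
  | _, [] => []
  | n, (a, none) :: rest => (a, none) :: incAtList n rest
  | n, (a, some t) :: rest => (a, some (incAt n t)) :: incAtList n rest
end

mutual
/-- Locator substitution `t[ρ^n ↦ u]`. -/
def subst : Tm L → Nat → Tm L → Tm L
  | loc m, n, u => if m < n then loc m else if m = n then u else loc (m - 1)
  | dot t a, n, u => dot (subst t n u) a
  | app t a v, n, u => app (subst t n u) a (subst v n u)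
  | obj attrs, n, u => obj (substList attrs (n + 1) (incAt 0 u))

def substList : List (L × Option (Tm L)) → Nat → Tm L → List (L × Option (Tm L))
  | [], _, _ => []
  | (a, none) :: rest, n, u => (a, none) :: substList rest n u
  | (a, some t) :: rest, n, u => (a, some (subst t n u)) :: substList rest n u
end

section Reductions

variable [DecidableEq L]

/-- One-step (regular) reduction `⇝`, parametrized by the decorator label `phi`. -/
inductive Step (phi : L) : Tm L → Tm L → Prop where
  | congObj {t t' : Tm L} (pre post : List (L × Option (Tm L))) (b : L) :
      Step phi t t' →
      Step phi (obj (pre ++ (b, some t) :: post)) (obj (pre ++ (b, some t') :: post))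
  | congDot {t t' : Tm L} (a : L) : Step phi t t' → Step phi (dot t a) (dot t' a)
  | congAppL {t t' u : Tm L} (a : L) : Step phi t t' → Step phi (app t a u) (app t' a u)
  | congAppR {t u u' : Tm L} (a : L) : Step phi u u' → Step phi (app t a u) (app t a u')
  | dotStep {attrs : List (L × Option (Tm L))} {c : L} {tc : Tm L} :
      lookupAttr c attrs = some (some tc) →
      Step phi (dot (obj attrs) c) (subst tc 0 (obj attrs))
  | dotPhi {attrs : List (L × Option (Tm L))} {c : L} :
      lookupAttr c attrs = none → (lookupAttr phi attrs).isSome →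
      Step phi (dot (obj attrs) c) (dot (dot (obj attrs) phi) c)
  | appStep {attrs : List (L × Option (Tm L))} {c : L} {u : Tm L} :
      lookupAttr c attrs = some none →
      Step phi (app (obj attrs) c u) (obj (attachAttr c (incAt 0 u) attrs))

mutual
/-- Parallel reduction `⇛`. -/
inductive Par (phi : L) : Tm L → Tm L → Prop where
  | loc (n : Nat) : Par phi (Tm.loc n) (Tm.loc n)
  | obj {attrs attrs' : List (L × Option (Tm L))} :
      ParAttrs phi attrs attrs' → Par phi (Tm.obj attrs) (Tm.obj attrs')
  | congDot {t t' : Tm L} (a : L) : Par phi t t' → Par phi (Tm.dot t a) (Tm.dot t' a)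
  | congApp {t t' u u' : Tm L} (a : L) :
      Par phi t t' → Par phi u u' → Par phi (Tm.app t a u) (Tm.app t' a u')
  | dotPar {t : Tm L} {attrs : List (L × Option (Tm L))} {c : L} {tc : Tm L} :
      Par phi t (Tm.obj attrs) → lookupAttr c attrs = some (some tc) →
      Par phi (Tm.dot t c) (subst tc 0 (Tm.obj attrs))
  | dotPhi {t : Tm L} {attrs : List (L × Option (Tm L))} {c : L} :
      Par phi t (Tm.obj attrs) → lookupAttr c attrs = none →
      (lookupAttr phi attrs).isSome →
      Par phi (Tm.dot t c) (Tm.dot (Tm.dot (Tm.obj attrs) phi) c)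
  | appPar {t : Tm L} {attrs : List (L × Option (Tm L))} {c : L} {u u' : Tm L} :
      Par phi t (Tm.obj attrs) → lookupAttr c attrs = some none → Par phi u u' →
      Par phi (Tm.app t c u) (Tm.obj (attachAttr c (incAt 0 u') attrs))

/-- Pointwise parallel reduction on attribute lists: void attributes are kept,
attached attributes reduce in parallel. -/
inductive ParAttrs (phi : L) :
    List (L × Option (Tm L)) → List (L × Option (Tm L)) → Prop where
  | nil : ParAttrs phi [] []
  | void {rest rest' : List (L × Option (Tm L))} (a : L) :
      ParAttrs phi rest rest' → ParAttrs phi ((a, none) :: rest) ((a, none) :: rest')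
  | attached {t t' : Tm L} {rest rest' : List (L × Option (Tm L))} (a : L) :
      Par phi t t' → ParAttrs phi rest rest' →
      ParAttrs phi ((a, some t) :: rest) ((a, some t') :: rest')
end

/-- Head reduction `→h`. -/
inductive Head (phi : L) : Tm L → Tm L → Prop where
  | dotStep {attrs : List (L × Option (Tm L))} {c : L} {tc : Tm L} :
      lookupAttr c attrs = some (some tc) →
      Head phi (dot (obj attrs) c) (subst tc 0 (obj attrs))
  | dotPhi {attrs : List (L × Option (Tm L))} {c : L} :
      lookupAttr c attrs = none → (lookupAttr phi attrs).isSome →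
      Head phi (dot (obj attrs) c) (dot (dot (obj attrs) phi) c)
  | appStep {attrs : List (L × Option (Tm L))} {c : L} {u : Tm L} :
      lookupAttr c attrs = some none →
      Head phi (app (obj attrs) c u) (obj (attachAttr c (incAt 0 u) attrs))
  | congDot {t t' : Tm L} (a : L) : Head phi t t' → Head phi (dot t a) (dot t' a)
  | congApp {t t' u : Tm L} (a : L) : Head phi t t' → Head phi (app t a u) (app t' a u)

/-- Internal parallel reduction `⇛ᵢ`. -/
inductive ParI (phi : L) : Tm L → Tm L → Prop where
  | loc (n : Nat) : ParI phi (Tm.loc n) (Tm.loc n)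
  | obj {attrs attrs' : List (L × Option (Tm L))} :
      ParAttrs phi attrs attrs' → ParI phi (Tm.obj attrs) (Tm.obj attrs')
  | congDot {t t' : Tm L} (a : L) : ParI phi t t' → ParI phi (Tm.dot t a) (Tm.dot t' a)
  | congApp {t t' u u' : Tm L} (a : L) :
      ParI phi t t' → Par phi u u' → ParI phi (Tm.app t a u) (Tm.app t' a u')

/-- Internal (regular) reduction `→ᵢ`. -/
inductive StepI (phi : L) : Tm L → Tm L → Prop where
  | congObj {t t' : Tm L} (pre post : List (L × Option (Tm L))) (b : L) :
      Step phi t t' →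
      StepI phi (obj (pre ++ (b, some t) :: post)) (obj (pre ++ (b, some t') :: post))
  | congDot {t t' : Tm L} (a : L) : StepI phi t t' → StepI phi (dot t a) (dot t' a)
  | congAppL {t t' u : Tm L} (a : L) : StepI phi t t' → StepI phi (app t a u) (app t' a u)
  | congAppR {t u u' : Tm L} (a : L) : Step phi u u' → StepI phi (app t a u) (app t a u')

end Reductions

end Tm

end PhiCalc
namespace PhiCalc
namespace Tm
section Extra
variable {L : Type} [DecidableEq L]

mutual
/-- Complete development `t⁺`. -/
def cd (phi : L) : Tm L → Tm L
  | loc n => loc n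
  | dot t a =>
    match cd phi t with
    | obj attrs =>
      match lookupAttr a attrs with
      | some (some ta) => subst ta 0 (obj attrs)
      | some none => dot (obj attrs) a
      | none =>
        if (lookupAttr phi attrs).isSome then dot (dot (obj attrs) phi) a
        else dot (obj attrs) a
    | t' => dot t' a
  | app t a u =>
    match cd phi t with
    | obj attrs =>
      match lookupAttr a attrs with
      | some none => obj (attachAttr a (incAt 0 (cd phi u)) attrs)
      | _ => app (obj attrs) a (cd phi u)
    | t' => app t' a (cd phi u)
  | obj attrs => obj (cdList phi attrs)

def cdList (phi : L) : List (L × Option (Tm L)) → List (L × Option (Tm L))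
  | [] => []
  | (a, none) :: rest => (a, none) :: cdList phi rest
  | (a, some t) :: rest => (a, some (cd phi t)) :: cdList phi rest
end

/-- Head reduction as a (deterministic) partial function. -/
def headRed (phi : L) : Tm L → Option (Tm L)
  | loc _ => none
  | obj _ => none
  | dot t a =>
    match t with
    | obj attrs =>
      match lookupAttr a attrs with
      | some (some ta) => some (subst ta 0 (obj attrs))
      | some none => none
      | none =>
        if (lookupAttr phi attrs).isSome then some (dot (dot (obj attrs) phi) a)
        else none
    | t => (headRed phi t).map (fun t' => dot t' a)
  | app t a u =>
    match t with
    | obj attrs =>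
      match lookupAttr a attrs with
      | some none => some (obj (attachAttr a (incAt 0 u) attrs))
      | _ => none
    | t => (headRed phi t).map (fun t' => app t' a u)

mutual
/-- Normal order reduction `⇝ℓ` as a (deterministic) partial function:
head reduction first, otherwise reduce the leftmost subterm that reduces. -/
def nordRed (phi : L) : Tm L → Option (Tm L)
  | loc _ => none
  | dot t a =>
    match headRed phi (dot t a) with
    | some s => some s
    | none => (nordRed phi t).map (fun t' => dot t' a)
  | app t a u =>
    match headRed phi (app t a u) with
    | some s => some s
    | none =>
      match nordRed phi t with
      | some t' => some (app t' a u)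
      | none => (nordRed phi u).map (fun u' => app t a u')
  | obj attrs => (nordList phi attrs).map obj

def nordList (phi : L) : List (L × Option (Tm L)) → Option (List (L × Option (Tm L)))
  | [] => none
  | (a, none) :: rest => (nordList phi rest).map (fun rest' => (a, none) :: rest')
  | (a, some t) :: rest =>
    match nordRed phi t with
    | some t' => some ((a, some t') :: rest)
    | none => (nordList phi rest).map (fun rest' => (a, some t) :: rest')
end

/-- Normal order reduction relation. -/
def NOrd (phi : L) (t t' : Tm L) : Prop := nordRed phi t = some t'

end Extra
end Tm
end PhiCalc
namespace PhiCalc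
namespace Tm

section Locators

variable {L : Type}

mutual
theorem incAt_incAt (m n : Nat) (h : m ≤ n) :
    ∀ t : Tm L, incAt (n + 1) (incAt m t) = incAt m (incAt n t)
  | loc k => by grind [incAt]
  | dot t a => by simp only [incAt, incAt_incAt m n h t]
  | app t a u => by simp only [incAt, incAt_incAt m n h t, incAt_incAt m n h u]
  | obj l => by
    simp only [incAt, incAtList_incAtList (m + 1) (n + 1) (Nat.succ_le_succ h) l]

theorem incAtList_incAtList (m n : Nat) (h : m ≤ n) :
    ∀ l : List (L × Option (Tm L)),
      incAtList (n + 1) (incAtList m l) = incAtList m (incAtList n l)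
  | [] => by simp only [incAtList]
  | (a, none) :: l => by simp only [incAtList, incAtList_incAtList m n h l]
  | (a, some t) :: l => by
    simp only [incAtList, incAt_incAt m n h t, incAtList_incAtList m n h l]
end

mutual
theorem subst_incAt_self (n : Nat) : ∀ (t u : Tm L), subst (incAt n t) n u = t
  | loc k, u => by grind [incAt, subst]
  | dot t a, u => by simp only [incAt, subst, subst_incAt_self n t]
  | app t a v, u => by simp only [incAt, subst, subst_incAt_self n t, subst_incAt_self n v]
  | obj l, u => by simp only [incAt, subst, substList_incAtList_self (n + 1) l]

theorem substList_incAtList_self (n : Nat) :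
    ∀ (l : List (L × Option (Tm L))) (u : Tm L), substList (incAtList n l) n u = l
  | [], u => by simp only [incAtList, substList]
  | (a, none) :: l, u => by simp only [incAtList, substList, substList_incAtList_self n l]
  | (a, some t) :: l, u => by
    simp only [incAtList, substList, subst_incAt_self n t, substList_incAtList_self n l]
end

mutual
/-- Increment below the substituted locator. -/
theorem subst_incAt_of_le (k n : Nat) (h : k ≤ n) :
    ∀ t u : Tm L, subst (incAt k t) (n + 1) (incAt k u) = incAt k (subst t n u)
  | loc m, u => by grind [incAt, subst]
  | dot t a, u => by simp only [incAt, subst, subst_incAt_of_le k n h t]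
  | app t a v, u => by
    simp only [incAt, subst, subst_incAt_of_le k n h t, subst_incAt_of_le k n h v]
  | obj l, u => by
    simp only [incAt, subst, ← incAt_incAt 0 k (Nat.zero_le k) u,
      substList_incAtList_of_le (k + 1) (n + 1) (Nat.succ_le_succ h) l]

theorem substList_incAtList_of_le (k n : Nat) (h : k ≤ n) :
    ∀ (l : List (L × Option (Tm L))) (u : Tm L),
      substList (incAtList k l) (n + 1) (incAt k u) = incAtList k (substList l n u)
  | [], u => by simp only [incAtList, substList]
  | (a, none) :: l, u => by
    simp only [incAtList, substList, substList_incAtList_of_le k n h l]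
  | (a, some t) :: l, u => by
    simp only [incAtList, substList, subst_incAt_of_le k n h t,
      substList_incAtList_of_le k n h l]
end

mutual
/-- Increment above the substituted locator. -/
theorem incAt_subst_of_le (n k : Nat) (h : n ≤ k) :
    ∀ t u : Tm L, incAt k (subst t n u) = subst (incAt (k + 1) t) n (incAt k u)
  | loc m, u => by grind [incAt, subst]
  | dot t a, u => by simp only [incAt, subst, incAt_subst_of_le n k h t]
  | app t a v, u => by
    simp only [incAt, subst, incAt_subst_of_le n k h t, incAt_subst_of_le n k h v]
  | obj l, u => by
    simp only [incAt, subst, ← incAt_incAt 0 k (Nat.zero_le k) u,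
      incAtList_substList_of_le (n + 1) (k + 1) (Nat.succ_le_succ h) l]

theorem incAtList_substList_of_le (n k : Nat) (h : n ≤ k) :
    ∀ (l : List (L × Option (Tm L))) (u : Tm L),
      incAtList k (substList l n u) = substList (incAtList (k + 1) l) n (incAt k u)
  | [], u => by simp only [incAtList, substList]
  | (a, none) :: l, u => by
    simp only [incAtList, substList, incAtList_substList_of_le n k h l]
  | (a, some t) :: l, u => by
    simp only [incAtList, substList, incAt_subst_of_le n k h t,
      incAtList_substList_of_le n k h l]
end

mutual
theorem subst_subst (m n : Nat) (h : m ≤ n) :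
    ∀ t w u : Tm L, subst (subst t m w) n u =
      subst (subst t (n + 1) (incAt m u)) m (subst w n u)
  | loc k, w, u => by grind [incAt, subst, subst_incAt_self]
  | dot t a, w, u => by simp only [subst, subst_subst m n h t w u]
  | app t a v, w, u => by
    simp only [subst, subst_subst m n h t w u, subst_subst m n h v w u]
  | obj l, w, u => by
    simp only [subst, ← incAt_incAt 0 m (Nat.zero_le m) u,
      ← subst_incAt_of_le 0 n (Nat.zero_le n) w u,
      substList_substList (m + 1) (n + 1) (Nat.succ_le_succ h) l (incAt 0 w) (incAt 0 u)]

theorem substList_substList (m n : Nat) (h : m ≤ n) :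
    ∀ (l : List (L × Option (Tm L))) (w u : Tm L), substList (substList l m w) n u =
      substList (substList l (n + 1) (incAt m u)) m (subst w n u)
  | [], w, u => by simp only [substList]
  | (a, none) :: l, w, u => by simp only [substList, substList_substList m n h l w u]
  | (a, some t) :: l, w, u => by
    simp only [substList, subst_subst m n h t w u, substList_substList m n h l w u]
end

end Locators

section Attributes

variable {L : Type} [DecidableEq L]

theorem lookupAttr_incAtList (c : L) (n : Nat) (l : List (L × Option (Tm L))) :
    lookupAttr c (incAtList n l) = (lookupAttr c l).map (Option.map (incAt n)) := by
  induction l with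
  | nil => rfl
  | cons p l ih =>
    obtain ⟨a, _ | t⟩ := p <;> simp only [incAtList, lookupAttr, ih] <;> split <;> rfl

theorem lookupAttr_substList (c : L) (n : Nat) (u : Tm L) (l : List (L × Option (Tm L))) :
    lookupAttr c (substList l n u) =
      (lookupAttr c l).map (Option.map fun t => subst t n u) := by
  induction l with
  | nil => rfl
  | cons p l ih =>
    obtain ⟨a, _ | t⟩ := p <;> simp only [substList, lookupAttr, ih] <;> split <;> rfl

theorem incAtList_attachAttr (c : L) (n : Nat) (v : Tm L) (l : List (L × Option (Tm L))) :
    incAtList n (attachAttr c v l) = attachAttr c (incAt n v) (incAtList n l) := by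
  induction l with
  | nil => simp only [attachAttr, incAtList]
  | cons p l ih =>
    obtain ⟨a, _ | t⟩ := p <;> simp only [incAtList, attachAttr] <;> split <;>
      simp only [incAtList, ih]

theorem substList_attachAttr (c : L) (n : Nat) (u v : Tm L)
    (l : List (L × Option (Tm L))) :
    substList (attachAttr c v l) n u = attachAttr c (subst v n u) (substList l n u) := by
  induction l with
  | nil => simp only [attachAttr, substList]
  | cons p l ih =>
    obtain ⟨a, _ | t⟩ := p <;> simp only [substList, attachAttr] <;> split <;>
      simp only [substList, ih]

end Attributes

section Parallel

variable {L : Type} [DecidableEq L] {phi : L}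

mutual
theorem Par.refl : ∀ t : Tm L, Par phi t t
  | loc n => .loc n
  | dot t a => .congDot a (Par.refl t)
  | app t a u => .congApp a (Par.refl t) (Par.refl u)
  | obj l => .obj (ParAttrs.refl l)

theorem ParAttrs.refl : ∀ l : List (L × Option (Tm L)), ParAttrs phi l l
  | [] => .nil
  | (a, none) :: l => .void a (ParAttrs.refl l)
  | (a, some t) :: l => .attached a (Par.refl t) (ParAttrs.refl l)
end

theorem ParAttrs.lookupAttr_eq_none {l l' : List (L × Option (Tm L))}
    (h : ParAttrs phi l l') (c : L) : lookupAttr c l = none ↔ lookupAttr c l' = none := by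
  induction l generalizing l' with
  | nil => cases h; rfl
  | cons p l ih =>
    cases h with
    | void a hl => simp only [lookupAttr]; split <;> simp [ih hl]
    | attached a ht hl => simp only [lookupAttr]; split <;> simp [ih hl]

theorem ParAttrs.lookupAttr_isSome {l l' : List (L × Option (Tm L))}
    (h : ParAttrs phi l l') {c : L} (hc : (lookupAttr c l).isSome) :
    (lookupAttr c l').isSome := by
  rw [Option.isSome_iff_ne_none] at hc ⊢
  exact fun h' => hc ((h.lookupAttr_eq_none c).2 h')

theorem ParAttrs.lookupAttr_void {l l' : List (L × Option (Tm L))}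
    (h : ParAttrs phi l l') {c : L} (hc : lookupAttr c l = some none) :
    lookupAttr c l' = some none := by
  induction l generalizing l' with
  | nil => simp [lookupAttr] at hc
  | cons p l ih => cases h <;> simp only [lookupAttr] at hc ⊢ <;> split <;> simp_all

theorem ParAttrs.lookupAttr_attached {l l' : List (L × Option (Tm L))}
    (h : ParAttrs phi l l') {c : L} {t : Tm L} (hc : lookupAttr c l = some (some t)) :
    ∃ t', lookupAttr c l' = some (some t') ∧ Par phi t t' := by
  induction l generalizing l' with
  | nil => simp [lookupAttr] at hc
  | cons p l ih => cases h <;> simp only [lookupAttr] at hc ⊢ <;> split <;> simp_all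

theorem ParAttrs.attachAttr {l l' : List (L × Option (Tm L))} (h : ParAttrs phi l l')
    (c : L) {u u' : Tm L} (hu : Par phi u u') :
    ParAttrs phi (attachAttr c u l) (attachAttr c u' l') := by
  induction l generalizing l' with
  | nil => cases h; exact .nil
  | cons p l ih =>
    cases h with
    | void a hl =>
      simp only [Tm.attachAttr]
      split
      · exact .attached _ hu hl
      · exact .void _ (ih hl)
    | attached a ht hl =>
      simp only [Tm.attachAttr]
      split
      · exact .attached _ hu hl
      · exact .attached _ ht (ih hl)

mutual
theorem Par.incAt : ∀ {t t' : Tm L}, Par phi t t' → ∀ n : Nat,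
    Par phi (incAt n t) (incAt n t')
  | _, _, .loc _, _ => .refl _
  | _, _, .obj h, n => by simpa only [Tm.incAt] using Par.obj (h.incAtList (n + 1))
  | _, _, .congDot a h, n => by simpa only [Tm.incAt] using Par.congDot a (h.incAt n)
  | _, _, .congApp a h hu, n => by
    simpa only [Tm.incAt] using Par.congApp a (h.incAt n) (hu.incAt n)
  | _, _, .dotPar h hc, n => by
    have h' := h.incAt n
    simp only [Tm.incAt] at h'
    simp only [Tm.incAt, incAt_subst_of_le 0 n (Nat.zero_le n)]
    exact .dotPar h' (by simp [lookupAttr_incAtList, hc])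
  | _, _, .dotPhi h hc hphi, n => by
    have h' := h.incAt n
    simp only [Tm.incAt] at h' ⊢
    exact .dotPhi h' (by simp [lookupAttr_incAtList, hc])
      (by simpa [lookupAttr_incAtList] using hphi)
  | _, _, .appPar h hc hu, n => by
    have h' := h.incAt n
    simp only [Tm.incAt] at h'
    simp only [Tm.incAt, incAtList_attachAttr, incAt_incAt 0 n (Nat.zero_le n)]
    exact .appPar h' (by simp [lookupAttr_incAtList, hc]) (hu.incAt n)

theorem ParAttrs.incAtList : ∀ {l l' : List (L × Option (Tm L))}, ParAttrs phi l l' →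
    ∀ n : Nat, ParAttrs phi (incAtList n l) (incAtList n l')
  | _, _, .nil, _ => .refl _
  | _, _, .void a h, n => by simpa only [Tm.incAtList] using ParAttrs.void a (h.incAtList n)
  | _, _, .attached a ht h, n => by
    simpa only [Tm.incAtList] using ParAttrs.attached a (ht.incAt n) (h.incAtList n)
end

mutual
theorem Par.subst : ∀ {t t' : Tm L}, Par phi t t' → ∀ (n : Nat) {u u' : Tm L},
    Par phi u u' → Par phi (subst t n u) (subst t' n u')
  | _, _, .loc _, _, _, _, hu => by
    simp only [Tm.subst]
    split
    · exact .refl _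
    · split
      · exact hu
      · exact .refl _
  | _, _, .obj h, n, _, _, hu => by
    simpa only [Tm.subst] using Par.obj (h.substList (n + 1) (hu.incAt 0))
  | _, _, .congDot a h, n, _, _, hu => by
    simpa only [Tm.subst] using Par.congDot a (h.subst n hu)
  | _, _, .congApp a h hv, n, _, _, hu => by
    simpa only [Tm.subst] using Par.congApp a (h.subst n hu) (hv.subst n hu)
  | _, _, .dotPar h hc, n, _, _, hu => by
    have h' := h.subst n hu
    simp only [Tm.subst] at h'
    rw [subst_subst 0 n (Nat.zero_le n)]
    simp only [Tm.subst]
    exact .dotPar h' (by simp [lookupAttr_substList, hc])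
  | _, _, .dotPhi h hc hphi, n, _, _, hu => by
    have h' := h.subst n hu
    simp only [Tm.subst] at h' ⊢
    exact .dotPhi h' (by simp [lookupAttr_substList, hc])
      (by simpa [lookupAttr_substList] using hphi)
  | _, _, .appPar h hc hv, n, _, _, hu => by
    have h' := h.subst n hu
    simp only [Tm.subst] at h'
    simp only [Tm.subst, substList_attachAttr, subst_incAt_of_le 0 n (Nat.zero_le n)]
    exact .appPar h' (by simp [lookupAttr_substList, hc]) (hv.subst n hu)

theorem ParAttrs.substList : ∀ {l l' : List (L × Option (Tm L))}, ParAttrs phi l l' →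
    ∀ (n : Nat) {u u' : Tm L}, Par phi u u' →
      ParAttrs phi (substList l n u) (substList l' n u')
  | _, _, .nil, _, _, _, _ => by simpa only [Tm.substList] using ParAttrs.nil
  | _, _, .void a h, n, _, _, hu => by
    simpa only [Tm.substList] using ParAttrs.void a (h.substList n hu)
  | _, _, .attached a ht h, n, _, _, hu => by
    simpa only [Tm.substList] using ParAttrs.attached a (ht.subst n hu) (h.substList n hu)
end

theorem Par.obj_left {l : List (L × Option (Tm L))} {t : Tm L}
    (h : Par phi (Tm.obj l) t) : ∃ l', t = Tm.obj l' ∧ ParAttrs phi l l' := by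
  cases h with
  | obj h => exact ⟨_, rfl, h⟩

mutual
/-- Every parallel reduct of `t` reduces in parallel to the complete development of `t`. -/
theorem Par.cd : ∀ {t t' : Tm L}, Par phi t t' → Par phi t' (cd phi t)
  | _, _, .loc _ => by simpa only [Tm.cd] using Par.loc _
  | _, _, .obj h => by simpa only [Tm.cd] using Par.obj h.cdList
  | _, _, .congDot a h => by
    have h' := h.cd
    simp only [Tm.cd]
    split
    · rename_i heq
      rw [heq] at h'
      split
      · exact .dotPar h' ‹_›
      · exact .congDot a h'
      · split
        · exact .dotPhi h' ‹_› ‹_›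
        · exact .congDot a h'
    · exact .congDot a h'
  | _, _, .congApp a h hu => by
    have h' := h.cd
    have hu' := hu.cd
    simp only [Tm.cd]
    split
    · rename_i heq
      rw [heq] at h'
      split
      · exact .appPar h' ‹_› hu'
      · exact .congApp a h' hu'
    · exact .congApp a h' hu'
  | _, _, .dotPar h hc => by
    obtain ⟨l, hl, hp⟩ := h.cd.obj_left
    obtain ⟨t', ht', hpt⟩ := hp.lookupAttr_attached hc
    simp only [Tm.cd, hl, ht']
    exact hpt.subst 0 (.obj hp)
  | _, _, .dotPhi h hc hphi => by
    obtain ⟨l, hl, hp⟩ := h.cd.obj_left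
    simp only [Tm.cd, hl, (hp.lookupAttr_eq_none _).1 hc, hp.lookupAttr_isSome hphi, if_true]
    exact .congDot _ (.congDot _ (.obj hp))
  | _, _, .appPar h hc hu => by
    obtain ⟨l, hl, hp⟩ := h.cd.obj_left
    simp only [Tm.cd, hl, hp.lookupAttr_void hc]
    exact .obj (hp.attachAttr _ (hu.cd.incAt 0))

theorem ParAttrs.cdList : ∀ {l l' : List (L × Option (Tm L))}, ParAttrs phi l l' →
    ParAttrs phi l' (cdList phi l)
  | _, _, .nil => by simpa only [Tm.cdList] using ParAttrs.nil
  | _, _, .void a h => by simpa only [Tm.cdList] using ParAttrs.void a h.cdList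
  | _, _, .attached a ht h => by
    simpa only [Tm.cdList] using ParAttrs.attached a ht.cd h.cdList
end

theorem ParAttrs.append_left (pre : List (L × Option (Tm L)))
    {l l' : List (L × Option (Tm L))} (h : ParAttrs phi l l') :
    ParAttrs phi (pre ++ l) (pre ++ l') := by
  induction pre with
  | nil => exact h
  | cons p pre ih =>
    obtain ⟨a, _ | t⟩ := p
    · exact .void a ih
    · exact .attached a (.refl t) ih

theorem Step.par {t t' : Tm L} (h : Step phi t t') : Par phi t t' := by
  induction h with
  | congObj pre post b _ ih => exact .obj (.append_left pre (.attached b ih (.refl post)))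
  | congDot a _ ih => exact .congDot a ih
  | congAppL a _ ih => exact .congApp a ih (.refl _)
  | congAppR a _ ih => exact .congApp a (.refl _) ih
  | dotStep hc => exact .dotPar (.refl _) hc
  | dotPhi hc hphi => exact .dotPhi (.refl _) hc hphi
  | appStep hc => exact .appPar (.refl _) hc (.refl _)

open Relation

theorem reflTransGen_step_dot {t t' : Tm L} (a : L) (h : ReflTransGen (Step phi) t t') :
    ReflTransGen (Step phi) (dot t a) (dot t' a) :=
  h.lift (fun t => dot t a) fun _ _ => .congDot a

theorem reflTransGen_step_app {t t' u u' : Tm L} (a : L)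
    (h : ReflTransGen (Step phi) t t') (hu : ReflTransGen (Step phi) u u') :
    ReflTransGen (Step phi) (app t a u) (app t' a u') :=
  (h.lift (fun t => app t a u) fun _ _ => .congAppL a).trans
    (hu.lift (fun u => app t' a u) fun _ _ => .congAppR a)

mutual
theorem Par.reflTransGen_step : ∀ {t t' : Tm L}, Par phi t t' →
    ReflTransGen (Step phi) t t'
  | _, _, .loc _ => .refl
  | _, _, .obj h => h.reflTransGen_step []
  | _, _, .congDot a h => reflTransGen_step_dot a h.reflTransGen_step
  | _, _, .congApp a h hu => reflTransGen_step_app a h.reflTransGen_step hu.reflTransGen_step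
  | _, _, .dotPar h hc => (reflTransGen_step_dot _ h.reflTransGen_step).tail (.dotStep hc)
  | _, _, .dotPhi h hc hphi =>
    (reflTransGen_step_dot _ h.reflTransGen_step).tail (.dotPhi hc hphi)
  | _, _, .appPar h hc hu =>
    (reflTransGen_step_app _ h.reflTransGen_step hu.reflTransGen_step).tail (.appStep hc)

theorem ParAttrs.reflTransGen_step : ∀ {l l' : List (L × Option (Tm L))},
    ParAttrs phi l l' → ∀ pre : List (L × Option (Tm L)),
      ReflTransGen (Step phi) (obj (pre ++ l)) (obj (pre ++ l'))
  | _, _, .nil, _ => .refl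
  | _, _, .void a h, pre => by
    have h' := h.reflTransGen_step (pre ++ [(a, none)])
    simpa using h'
  | _, _, .attached (t' := t') (rest := rest) a ht h, pre =>
    (ht.reflTransGen_step.lift (fun t => obj (pre ++ (a, some t) :: rest))
      fun _ _ => .congObj pre rest a).trans
      (by simpa using h.reflTransGen_step (pre ++ [(a, some t')]))
end

/-- Confluence of `⇝`. -/
theorem step_confluent {t u v : Tm L} (hu : ReflTransGen (Step phi) t u)
    (hv : ReflTransGen (Step phi) t v) : Join (ReflTransGen (Step phi)) u v := by
  obtain ⟨w, huw, hvw⟩ := church_rosser (r := Par phi)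
    (fun a _ _ hb hc => ⟨Tm.cd phi a, .single hb.cd, .single hc.cd⟩)
    (hu.lift id fun _ _ => Step.par) (hv.lift id fun _ _ => Step.par)
  exact ⟨w, huw.lift' id fun _ _ => Par.reflTransGen_step,
    hvw.lift' id fun _ _ => Par.reflTransGen_step⟩

end Parallel

end Tm
end PhiCalc

open PhiCalc Tm in
/-- Uniqueness of normal form: if `t ⇝* u` and `t ⇝* v` with `u`, `v` both in
normal form (no `⇝` step applies), then `u = v`. -/
theorem normal_form_unique {L : Type} [DecidableEq L] (phi : L) {t u v : Tm L}
    (htu : Relation.ReflTransGen (Step phi) t u)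
    (htv : Relation.ReflTransGen (Step phi) t v)
    (hu : ∀ u' : Tm L, ¬ Step phi u u') (hv : ∀ v' : Tm L, ¬ Step phi v v') :
    u = v := by
  obtain ⟨w, huw, hvw⟩ := step_confluent htu htv
  have eq_of_normal {s : Tm L} (hs : ∀ s', ¬ Step phi s s')
      (h : Relation.ReflTransGen (Step phi) s w) : s = w :=
    h.cases_head.resolve_right fun ⟨s', hs', _⟩ => hs s' hs'
  rw [eq_of_normal hu huw, eq_of_normal hv hvw]
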